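/- arXiv:0904.1703 — 3 statements merged into one kernel-verified Lean document; each statement's English description precedes it below -/
import Mathlib

section
/- For every finite directed graph G and every natural number k, Cops have a winning strategy in the entanglement game Ent(G,k) if and only if Cops have a winning strategy in the modified game ET(G,k), which is played like Ent(G,k) except that in each Cops' move Cops are additionally allowed to retire any subset of the cops currently placed on the graph (i.e. Cops may move from (g,C,Cops) to (g,C',Robber) with C' ⊆ C, or to (g,C' ∪ {g},Robber) with C' ⊆ C). -/
/-!
Entanglement games on finite directed graphs (given by an adjacency relation
`E : V → V → Prop`).

A position of the game `Ent(G,k)` is `(v, C, P)` with `v : V`, `C : Finset V`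
(`C.card ≤ k`), and `P ∈ {Cops, Robber}`.  From `(v, C, Cops)`, Cops may skip,
add a cop on `v` (if at most `k` cops are then placed), or move a placed cop
to `v`.  From `(v, C, Robber)`, Robber moves along an edge to a vertex not
occupied by a cop.  Cops win exactly the finite plays, so "Cops have a winning
strategy from `(v, C, Cops)`" is the inductively defined predicate
`EntCopsWinFrom`: Cops can make a legal move after which every Robber move
leads to a position from which Cops again win (in particular, if Robber is
stuck, Cops have won).  Cops win the game `Ent(G,k)` if they win from every
initial position `(v₀, ∅, Cops)`.
-/

variable {V : Type*} [DecidableEq V]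

/-- A legal Cops move in the game `Ent(G,k)`: from position `(v, C, Cops)`
Cops may go to `(v, C', Robber)` where `C'` is `C` (skip), `C ∪ {v}` provided
at most `k` cops are used (add), or `(C \ {x}) ∪ {v}` for some `x ∈ C`
(move a placed cop). -/
def EntCopsMove (k : ℕ) (v : V) (C C' : Finset V) : Prop :=
  C' = C ∨ (C' = insert v C ∧ (insert v C).card ≤ k) ∨
    ∃ x ∈ C, C' = insert v (C.erase x)

/-- Cops have a winning strategy in `Ent(G,k)` from position `(v, C, Cops)`. -/
inductive EntCopsWinFrom (E : V → V → Prop) (k : ℕ) : V → Finset V → Prop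
  | step (v : V) (C C' : Finset V) (hmove : EntCopsMove k v C C')
      (h : ∀ v', E v v' → v' ∉ C' → EntCopsWinFrom E k v' C') :
      EntCopsWinFrom E k v C

/-- Cops have a winning strategy in the game `Ent(G,k)`. -/
def EntCopsWin (E : V → V → Prop) (k : ℕ) : Prop :=
  ∀ v : V, EntCopsWinFrom E k v ∅

/-- A legal Cops move in the modified game `ET(G,k)`: from `(v, C, Cops)` Cops
may additionally retire any subset of the placed cops, i.e. they move to
`(v, C', Robber)` with `C' ⊆ C` (generalized skip), or to
`(v, C' ∪ {v}, Robber)` with `C' ⊆ C` (generalized replace), using at most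
`k` cops. -/
def ETCopsMove (k : ℕ) (v : V) (C C' : Finset V) : Prop :=
  C' ⊆ C ∨ ∃ D ⊆ C, C' = insert v D ∧ (insert v D).card ≤ k

/-- Cops have a winning strategy in `ET(G,k)` from position `(v, C, Cops)`. -/
inductive ETCopsWinFrom (E : V → V → Prop) (k : ℕ) : V → Finset V → Prop
  | step (v : V) (C C' : Finset V) (hmove : ETCopsMove k v C C')
      (h : ∀ v', E v v' → v' ∉ C' → ETCopsWinFrom E k v' C') :
      ETCopsWinFrom E k v C

/-- Cops have a winning strategy in the game `ET(G,k)`. -/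
def ETCopsWin (E : V → V → Prop) (k : ℕ) : Prop :=
  ∀ v : V, ETCopsWinFrom E k v ∅

theorem EntCopsMove.card_le {k : ℕ} {v : V} {C C' : Finset V}
    (h : EntCopsMove k v C C') (hC : C.card ≤ k) : C'.card ≤ k := by
  rcases h with rfl | ⟨rfl, h⟩ | ⟨x, hx, rfl⟩
  · exact hC
  · exact h
  · have := Finset.card_insert_le v (C.erase x)
    have := Finset.card_erase_add_one hx
    omega

theorem EntCopsMove.etCopsMove {k : ℕ} {v : V} {C C' : Finset V}
    (h : EntCopsMove k v C C') (hC : C.card ≤ k) : ETCopsMove k v C C' := by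
  have hcard := h.card_le hC
  rcases h with rfl | ⟨rfl, -⟩ | ⟨x, -, rfl⟩
  · exact Or.inl subset_rfl
  · exact Or.inr ⟨C, subset_rfl, rfl, hcard⟩
  · exact Or.inr ⟨C.erase x, C.erase_subset x, rfl, hcard⟩

theorem EntCopsWinFrom.etCopsWinFrom {E : V → V → Prop} {k : ℕ}
    {v : V} {C : Finset V} (h : EntCopsWinFrom E k v C) (hC : C.card ≤ k) :
    ETCopsWinFrom E k v C := by
  induction h with
  | step v C C' hmove _ ih =>
    exact .step v C C' (hmove.etCopsMove hC) fun v' hE hv' => ih v' hE hv' (hmove.card_le hC)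

/-- With additional cops on the graph, a move of `ET(G,k)` is matched by a move of `Ent(G,k)`
that occupies at least the same vertices: retired cops stay in place until they are needed. -/
theorem ETCopsMove.exists_entCopsMove {k : ℕ} {v : V}
    {C C' D : Finset V} (h : ETCopsMove k v C C') (hCD : C ⊆ D) :
    ∃ D', EntCopsMove k v D D' ∧ C' ⊆ D' := by
  rcases h with h | ⟨A, hA, rfl, hcard⟩
  · exact ⟨D, Or.inl rfl, h.trans hCD⟩
  have hAD := hA.trans hCD
  by_cases hv : v ∈ D
  · exact ⟨D, Or.inl rfl, Finset.insert_subset hv hAD⟩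
  by_cases hk : (insert v D).card ≤ k
  · exact ⟨insert v D, Or.inr (Or.inl ⟨rfl, hk⟩), Finset.insert_subset_insert v hAD⟩
  rw [Finset.card_insert_of_notMem hv] at hk
  rw [Finset.card_insert_of_notMem fun h => hv (hAD h)] at hcard
  obtain ⟨x, hxD, hxA⟩ := Finset.exists_mem_notMem_of_card_lt_card (s := A) (t := D) (by omega)
  exact ⟨insert v (D.erase x), Or.inr (Or.inr ⟨x, hxD, rfl⟩),
    Finset.insert_subset_insert v (Finset.subset_erase.2 ⟨hAD, hxA⟩)⟩

theorem ETCopsWinFrom.entCopsWinFrom {E : V → V → Prop} {k : ℕ}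
    {v : V} {C D : Finset V} (h : ETCopsWinFrom E k v C) (hCD : C ⊆ D) :
    EntCopsWinFrom E k v D := by
  induction h generalizing D with
  | step v C C' hmove _ ih =>
    obtain ⟨D', hD', hsub⟩ := hmove.exists_entCopsMove hCD
    exact .step v D D' hD' fun v' hE hv' => ih v' hE (fun h => hv' (hsub h)) hsub

/-- For every finite directed graph `G` and every `k`, Cops have a winning
strategy in `Ent(G,k)` if and only if they have one in the modified game
`ET(G,k)` in which Cops may also retire placed cops. -/
theorem entCopsWin_iff_etCopsWin {V : Type*} [Fintype V] [DecidableEq V]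
    (E : V → V → Prop) (k : ℕ) :
    EntCopsWin E k ↔ ETCopsWin E k :=
  ⟨fun h v => (h v).etCopsWinFrom (by simp), fun h v => (h v).entCopsWinFrom subset_rfl⟩
end

section
/- If a finite undirected graph G is obtained from a finite undirected graph H by contracting an edge ab of H to a new vertex z (the new vertex z inheriting all neighbors of a and b), then Ent(G) ≤ Ent(H). -/
/-!
The entanglement game `Ent(G,k)` on a graph with adjacency relation
`E : V → V → Prop` is played by Robber against `k` cops.  Positions are
`(v, C, P)` with `v : V`, `C : Finset V` with `C.card ≤ k`, and
`P ∈ {Cops, Robber}`.  Initially Robber chooses `v₀` and moves to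
`(v₀, ∅, Cops)`.  From `(v, C, Cops)`, Cops may skip, add a cop on `v`
(if at most `k` cops are then placed), or move a placed cop to `v`; from
`(v, C, Robber)`, Robber moves along an edge to a vertex free of cops.
Every finite play is a win for Cops, so "Cops have a winning strategy from
`(v, C, Cops)`" is the inductive predicate `EntCopsWinFrom`.  The
entanglement of the graph is the least `k` such that Cops have a winning
strategy in `Ent(G,k)` (it is at most the number of vertices).
-/

variable {V : Type*} [DecidableEq V]

/-- The entanglement of a graph: the least number `k` of cops such that Cops
have a winning strategy in the game `Ent(G,k)`. -/
noncomputable def entanglement (E : V → V → Prop) : ℕ :=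
  sInf {k | EntCopsWin E k}

theorem EntCopsMove.subset_insert {k : ℕ} {v : V} {C C' : Finset V}
    (h : EntCopsMove k v C C') : C' ⊆ insert v C := by
  rcases h with rfl | ⟨rfl, -⟩ | ⟨x, -, rfl⟩
  · exact Finset.subset_insert _ _
  · exact subset_rfl
  · exact Finset.insert_subset_insert _ (Finset.erase_subset _ _)

theorem EntCopsMove.eq_or_mem {k : ℕ} {v : V} {C C' : Finset V}
    (h : EntCopsMove k v C C') : C' = C ∨ v ∈ C' := by
  rcases h with rfl | ⟨rfl, -⟩ | ⟨x, -, rfl⟩ <;> simp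

/-- As many cops as there are vertices win the entanglement game: they occupy every vertex that
Robber visits. -/
theorem entCopsWin_card [Fintype V] (E : V → V → Prop) : EntCopsWin E (Fintype.card V) := by
  have key : ∀ (n : ℕ) (C : Finset V) (v : V), Cᶜ.card = n → v ∉ C →
      EntCopsWinFrom E (Fintype.card V) v C := by
    intro n
    induction n using Nat.strong_induction_on with
    | _ n ih =>
      intro C v hn hv
      refine .step v C (insert v C) (Or.inr (Or.inl ⟨rfl, Finset.card_le_univ _⟩)) ?_
      intro v' _ hv'
      refine ih _ ?_ _ v' rfl hv'
      rw [← hn]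
      exact Finset.card_lt_card
        (Finset.compl_ssubset_compl.mpr (Finset.ssubset_insert hv))
  exact fun v => key _ ∅ v rfl (Finset.notMem_empty v)

/-- A Cops move transfers along a map `f` to a position whose cops cover the images of the
original ones. -/
theorem EntCopsMove.exists_image_subset {W : Type*} [DecidableEq W] {k : ℕ} {v : V}
    {C C' : Finset V} (h : EntCopsMove k v C C') (hC : C.card ≤ k) (f : V → W) {D : Finset W}
    (hCD : C.image f ⊆ D) (hD : D.card ≤ k) :
    ∃ D', EntCopsMove k (f v) D D' ∧ C'.image f ⊆ D' ∧ D'.card ≤ k := by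
  rcases h.eq_or_mem with rfl | hv
  · exact ⟨D, Or.inl rfl, hCD, hD⟩
  have hsub : (C'.erase v).image f ⊆ D := by
    refine (Finset.image_subset_image ?_).trans hCD
    exact (Finset.erase_subset_erase v h.subset_insert).trans (Finset.erase_insert_subset v C)
  have himage : C'.image f = insert (f v) ((C'.erase v).image f) := by
    rw [← Finset.image_insert, Finset.insert_erase hv]
  by_cases hins : (insert (f v) D).card ≤ k
  · exact ⟨_, Or.inr (Or.inl ⟨rfl, hins⟩),
      himage ▸ Finset.insert_subset_insert _ hsub, hins⟩
  have hlt : ((C'.erase v).image f).card < D.card := by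
    have h₁ := Finset.card_insert_le (f v) D
    have h₂ := Finset.card_erase_add_one hv
    have h₃ := h.card_le hC
    have h₄ := Finset.card_image_le (s := C'.erase v) (f := f)
    omega
  obtain ⟨x, hxD, hx⟩ := Finset.exists_mem_notMem_of_card_lt_card hlt
  have hmove : EntCopsMove k (f v) D (insert (f v) (D.erase x)) := Or.inr (Or.inr ⟨x, hxD, rfl⟩)
  exact ⟨_, hmove,
    himage ▸ Finset.insert_subset_insert _ (Finset.subset_erase.mpr ⟨hsub, hx⟩),
    hmove.card_le hD⟩

/-- Suppose that the edges of `E` lift along `f` to edges of `F`, and that the fibres of `f` have at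
most two elements, which are adjacent. Then a winning position for Cops in the game on `F` gives
one in the game on `E`, as soon as Cops cover the images of the cops in `F`. While Cops skip in
`F`, Robber is made to run back and forth inside a fibre. -/
theorem EntCopsWinFrom.map {W : Type*} [DecidableEq W] {E : W → W → Prop} {F : V → V → Prop}
    {k : ℕ} (f : V → W) (hE : ∀ x y, E x y → ∃ u v, f u = x ∧ f v = y ∧ F u v)
    (hfib : ∀ u v, u ≠ v → f u = f v → F u v)
    (htwo : ∀ u v w, u ≠ v → w ≠ v → f u = f v → f w = f v → u = w)
    {v : V} {C : Finset V} (hwin : EntCopsWinFrom F k v C) (hC : C.card ≤ k) {D : Finset W}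
    (hCD : C.image f ⊆ D) (hD : D.card ≤ k) (hv : f v ∉ D) : EntCopsWinFrom E k (f v) D := by
  have notMem {C : Finset V} {D : Finset W} {u : V} (hCD : C.image f ⊆ D) (hu : f u ∉ D) :
      u ∉ C := fun h => hu (hCD (Finset.mem_image_of_mem f h))
  -- the second component looks one further move ahead, past a detour inside a fibre
  suffices (∀ D : Finset W, C.image f ⊆ D → D.card ≤ k → f v ∉ D → EntCopsWinFrom E k (f v) D) ∧
      ∃ C', EntCopsMove k v C C' ∧ ∀ v', F v v' → ∀ D : Finset W, C'.image f ⊆ D → D.card ≤ k →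
        f v' ∉ D → EntCopsWinFrom E k (f v') D from this.1 D hCD hD hv
  clear hCD hD hv D
  induction hwin with
  | step v C C' hmove h ih =>
    have hC' := hmove.card_le hC
    have next : ∀ v', F v v' → ∀ D : Finset W, C'.image f ⊆ D → D.card ≤ k →
        f v' ∉ D → EntCopsWinFrom E k (f v') D := fun v' hv' D hCD hD hvD =>
      (ih v' hv' (notMem hCD hvD) hC').1 D hCD hD hvD
    refine ⟨fun D hCD hD hvD => ?_, C', hmove, next⟩
    obtain ⟨D', hmove', hCD', hD'⟩ := hmove.exists_image_subset hC f hCD hD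
    by_cases hw : ∃ w, w ≠ v ∧ f w = f v
    · obtain ⟨w, hwv, hfw⟩ := hw
      have hFvw : F v w := hfib v w hwv.symm hfw.symm
      rcases hmove.eq_or_mem with rfl | hvC'
      · exact hfw ▸ next w hFvw D hCD hD (hfw ▸ hvD)
      have hvD' : f v ∈ D' := hCD' (Finset.mem_image_of_mem f hvC')
      have hwC' : w ∉ C' := fun hmem =>
        (Finset.mem_insert.mp (hmove.subset_insert hmem)).elim hwv
          (notMem hCD (hfw ▸ hvD))
      refine .step _ _ D' hmove' fun y hy hyD' => ?_
      obtain ⟨u, y', hu, rfl, hFu⟩ := hE _ _ hy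
      by_cases huv : u = v
      · exact next y' (huv ▸ hFu) D' hCD' hD' hyD'
      obtain rfl := htwo u v w huv hwv hu hfw
      obtain ⟨C'', hmove'', h''⟩ := (ih u hFvw hwC' hC').2
      refine h'' y' hFu D' ?_ hD' hyD'
      refine (Finset.image_subset_image hmove''.subset_insert).trans ?_
      rw [Finset.image_insert, hu]
      exact Finset.insert_subset hvD' hCD'
    · refine .step _ _ D' hmove' fun y hy hyD' => ?_
      obtain ⟨u, y', hu, rfl, hFu⟩ := hE _ _ hy
      obtain rfl : u = v := by
        by_contra huv
        exact hw ⟨u, huv, hu⟩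
      exact next y' hFu D' hCD' hD' hyD'

/-- If the finite graph `G` is obtained from the finite graph `H` by
contracting an edge `ab` of `H` to a new vertex `z` (which inherits all the
neighbours of `a` and `b`; the contraction is witnessed by the map
`f : V_H → V_G` sending `a` and `b` to `z` and every other vertex to itself),
then `Ent(G) ≤ Ent(H)`. -/
theorem entanglement_contraction_le {α β : Type*}
    [Fintype α] [DecidableEq α] [Fintype β] [DecidableEq β]
    (G : SimpleGraph α) (H : SimpleGraph β) (a b : β) (z : α) (f : β → α)
    (hab : H.Adj a b) (hfa : f a = z) (hfb : f b = z)
    (hsurj : Function.Surjective f)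
    (hinj : ∀ u v : β, u ≠ v → f u = f v → (u = a ∧ v = b) ∨ (u = b ∧ v = a))
    (hadj : ∀ x y : α,
      G.Adj x y ↔ x ≠ y ∧ ∃ u v : β, f u = x ∧ f v = y ∧ H.Adj u v) :
    entanglement G.Adj ≤ entanglement H.Adj := by
  refine Nat.sInf_le fun x => ?_
  obtain ⟨v, rfl⟩ := hsurj x
  have hwin : EntCopsWin H.Adj (entanglement H.Adj) :=
    Nat.sInf_mem (s := {k | EntCopsWin H.Adj k}) ⟨_, entCopsWin_card H.Adj⟩
  refine (hwin v).map f (fun x y hxy => ((hadj x y).mp hxy).2) ?_ ?_ (by simp) (by simp) (by simp)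
    (by simp)
  · intro u v huv hf
    rcases hinj u v huv hf with ⟨rfl, rfl⟩ | ⟨rfl, rfl⟩
    exacts [hab, hab.symm]
  · intro u v w huv hwv hfu hfw
    have hne := hab.ne
    rcases hinj u v huv hfu with ⟨rfl, rfl⟩ | ⟨rfl, rfl⟩ <;>
      rcases hinj w _ hwv hfw with ⟨rfl, h⟩ | ⟨rfl, h⟩ <;> simp_all
end

section
/- If a finite undirected graph G is obtained from a finite undirected graph H by contracting an edge ab to a new vertex z, then the vertex-deleted graph H \ a is isomorphic to a subgraph of G, and consequently Ent(H \ a) ≤ Ent(G) and Ent(H) − 1 ≤ Ent(G). -/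
/-!
The entanglement game `Ent(G,k)` on a graph with adjacency relation
`E : V → V → Prop` is played by Robber against `k` cops.  Positions are
`(v, C, P)` with `v : V`, `C : Finset V` with `C.card ≤ k`, and
`P ∈ {Cops, Robber}`.  Initially Robber chooses `v₀` and moves to
`(v₀, ∅, Cops)`.  From `(v, C, Cops)`, Cops may skip, add a cop on `v`
(if at most `k` cops are then placed), or move a placed cop to `v`; from
`(v, C, Robber)`, Robber moves along an edge to a vertex free of cops.
Every finite play is a win for Cops, so "Cops have a winning strategy from
`(v, C, Cops)`" is the inductive predicate `EntCopsWinFrom`.  The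
entanglement of the graph is the least `k` such that Cops have a winning
strategy in `Ent(G,k)` (it is at most the number of vertices).
-/

variable {V : Type*} [DecidableEq V]

theorem EntCopsMove.eq_or_mem_and_subset {k : ℕ} {v : V} {C C' : Finset V}
    (h : EntCopsMove k v C C') : C' = C ∨ v ∈ C' ∧ C' ⊆ insert v C := by
  rcases h with h | ⟨rfl, -⟩ | ⟨x, -, rfl⟩
  · exact .inl h
  · exact .inr ⟨Finset.mem_insert_self _ _, subset_rfl⟩
  · exact .inr ⟨Finset.mem_insert_self _ _, Finset.insert_subset_insert _ (Finset.erase_subset _ _)⟩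

/-- Transfer of a winning strategy for `k` cops on a graph `E₂` to a graph `E₁`, along a partial
correspondence `ι w ↔ φ w`.  The cops on the vertices of `F` never move, and the remaining cops
guard at least the vertices corresponding to those guarded in `E₂`. -/
theorem EntCopsWinFrom.transfer {V₁ V₂ W : Type*} [DecidableEq V₁] [DecidableEq V₂]
    {E₁ : V₁ → V₁ → Prop} {E₂ : V₂ → V₂ → Prop} {k m : ℕ} {ι : W → V₁} {φ : W → V₂}
    (hφ : Function.Injective φ) (F : Finset V₁) (hm : k + F.card ≤ m)
    (hE : ∀ w y, E₁ (ι w) y → y ∉ F → (∃ w', ι w' = y ∧ E₂ (φ w) (φ w')) ∨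
      ∀ D : Finset V₁, D.card ≤ k + F.card → EntCopsWinFrom E₁ m y D)
    {u : V₂} {C : Finset V₂} (h : EntCopsWinFrom E₂ k u C) (hC : C.card ≤ k)
    {w : W} (hw : φ w = u) {D : Finset V₁} (hF : F ⊆ D) (hD : D.card ≤ k + F.card)
    (hCD : ∀ d, φ d ∈ C → ι d ∈ D) : EntCopsWinFrom E₁ m (ι w) D := by
  induction h generalizing w D with
  | step u C C' hmove _ ih =>
    subst hw
    have hC' := hmove.card_le hC
    suffices ∃ D', EntCopsMove m (ι w) D D' ∧ F ⊆ D' ∧ D'.card ≤ k + F.card ∧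
        ∀ d, φ d ∈ C' → ι d ∈ D' by
      obtain ⟨D', hmove', hFD', hD', hCD'⟩ := this
      refine .step _ _ D' hmove' fun y hy hyD' => ?_
      rcases hE w y hy (fun hyF => hyD' (hFD' hyF)) with ⟨w', rfl, hw'⟩ | hwin
      · exact ih _ hw' (fun hmem => hyD' (hCD' _ hmem)) hC' rfl hFD' hD' hCD'
      · exact hwin D' hD'
    rcases hmove.eq_or_mem_and_subset with rfl | ⟨hmem, hsub⟩
    · exact ⟨D, .inl rfl, hF, hD, hCD⟩
    have hold : ∀ d, φ d ∈ C' → d = w ∨ ι d ∈ D := fun d hd => by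
      rcases Finset.mem_insert.1 (hsub hd) with h | h
      · exact .inl (hφ h)
      · exact .inr (hCD d h)
    by_cases hadd : (insert (ι w) D).card ≤ k + F.card
    · refine ⟨insert (ι w) D, .inr (.inl ⟨rfl, hadd.trans hm⟩),
        hF.trans (Finset.subset_insert _ _), hadd, fun d hd => ?_⟩
      rcases hold d hd with rfl | h
      · exact Finset.mem_insert_self _ _
      · exact Finset.mem_insert_of_mem h
    have hwD : ι w ∉ D := fun h => hadd (by rwa [Finset.insert_eq_of_mem h])
    rw [Finset.card_insert_of_notMem hwD] at hadd
    -- Some mobile cop stands on a vertex that the strategy on `E₂` leaves unguarded.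
    obtain ⟨y, hyD, hyF, hy⟩ : ∃ y ∈ D, y ∉ F ∧ ∀ d, φ d ∈ C' → ι d ≠ y := by
      by_contra! hcon
      have hsub' : insert (ι w) (D \ F) ⊆ (C'.preimage φ hφ.injOn).image ι := by
        intro y hy
        rw [Finset.mem_image]
        rcases Finset.mem_insert.1 hy with rfl | hy
        · exact ⟨w, Finset.mem_preimage.2 hmem, rfl⟩
        · obtain ⟨hyD, hyF⟩ := Finset.mem_sdiff.1 hy
          obtain ⟨d, hd, rfl⟩ := hcon y hyD hyF
          exact ⟨d, Finset.mem_preimage.2 hd, rfl⟩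
      have h₁ := Finset.card_le_card hsub'
      rw [Finset.card_insert_of_notMem (fun h => hwD (Finset.mem_sdiff.1 h).1),
        Finset.card_sdiff_of_subset hF] at h₁
      have h₂ := Finset.card_image_le (s := C'.preimage φ hφ.injOn) (f := ι)
      have h₃ : (C'.preimage φ hφ.injOn).card ≤ C'.card :=
        Finset.card_le_card_of_injOn φ (fun _ h => Finset.mem_preimage.1 h) hφ.injOn
      omega
    refine ⟨insert (ι w) (D.erase y), .inr (.inr ⟨y, hyD, rfl⟩), fun x hx => ?_, ?_, fun d hd => ?_⟩
    · exact Finset.mem_insert_of_mem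
        (Finset.mem_erase.2 ⟨fun h => hyF (h ▸ hx), hF hx⟩)
    · have h₁ := Finset.card_insert_le (ι w) (D.erase y)
      have h₂ := Finset.card_erase_add_one hyD
      omega
    · rcases hold d hd with rfl | h
      · exact Finset.mem_insert_self _ _
      · exact Finset.mem_insert_of_mem (Finset.mem_erase.2 ⟨hy d hd, h⟩)

/-- Entanglement winning strategies pull back along injective homomorphisms. -/
theorem EntCopsWin.of_injective_hom {V₁ V₂ : Type*} [DecidableEq V₁] [DecidableEq V₂]
    {E₁ : V₁ → V₁ → Prop} {E₂ : V₂ → V₂ → Prop} {k : ℕ} {φ : V₁ → V₂}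
    (hφ : Function.Injective φ) (hE : ∀ u v, E₁ u v → E₂ (φ u) (φ v)) (h : EntCopsWin E₂ k) :
    EntCopsWin E₁ k := fun v =>
  (h (φ v)).transfer (ι := id) hφ ∅ (by simp)
    (fun w y hy _ => .inl ⟨y, rfl, hE w y hy⟩) (by simp) rfl (by simp) (by simp) (by simp)

/-- Deleting one vertex saves at most one cop. -/
theorem EntCopsWin.succ_of_induce_compl_singleton {H : SimpleGraph V} {a : V} {k : ℕ}
    (h : EntCopsWin (H.induce ({a}ᶜ : Set V)).Adj k) : EntCopsWin H.Adj (k + 1) := by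
  have hguarded : ∀ (w : V) (D : Finset V), w ≠ a → a ∈ D → D.card ≤ k + 1 →
      EntCopsWinFrom H.Adj (k + 1) w D := fun w D hw ha hD =>
    (h ⟨w, hw⟩).transfer (ι := Subtype.val) (φ := id) (w := ⟨w, hw⟩) Function.injective_id {a}
      (by simp) (fun u y hy hya => .inl ⟨⟨y, by simpa using hya⟩, rfl, hy⟩)
      (by simp) rfl (by simpa using ha) (by simpa using hD) (by simp)
  have harrive : ∀ D : Finset V, D.card ≤ k → EntCopsWinFrom H.Adj (k + 1) a D := fun D hD => by
    have hcard : (insert a D).card ≤ k + 1 := (Finset.card_insert_le a D).trans (by omega)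
    exact .step _ _ _ (.inr (.inl ⟨rfl, hcard⟩)) fun y hy _ =>
      hguarded y _ hy.ne' (Finset.mem_insert_self _ _) hcard
  intro v
  by_cases hv : v = a
  · subst hv
    exact harrive ∅ (by simp)
  · refine (h ⟨v, hv⟩).transfer (ι := Subtype.val) (φ := id) (w := ⟨v, hv⟩)
      Function.injective_id ∅ (by simp) (fun u y hy _ => ?_)
      (by simp) rfl (by simp) (by simp) (by simp)
    by_cases hya : y = a
    · subst hya
      exact .inr (by simpa using harrive)
    · exact .inl ⟨⟨y, hya⟩, rfl, hy⟩

theorem EntCopsWin.entanglement_le {E : V → V → Prop} {k : ℕ} (h : EntCopsWin E k) :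
    entanglement E ≤ k :=
  Nat.sInf_le h

theorem entCopsWin_entanglement [Fintype V] (E : V → V → Prop) : EntCopsWin E (entanglement E) :=
  Nat.sInf_mem (s := {k | EntCopsWin E k}) ⟨_, entCopsWin_card E⟩

/-- If the finite graph `G` is obtained from the finite graph `H` by
contracting an edge `ab` to a new vertex `z` (the contraction being witnessed
by the surjection `f : V_H → V_G` identifying exactly `a` and `b` into `z`),
then the vertex-deleted graph `H \ a` is isomorphic to a subgraph of `G`
(there is an injective graph homomorphism of `H \ a` into `G`), and
consequently `Ent(H \ a) ≤ Ent(G)` and `Ent(H) - 1 ≤ Ent(G)`. -/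
theorem contraction_vertexDeleted_subgraph {α β : Type*}
    [Fintype α] [DecidableEq α] [Fintype β] [DecidableEq β]
    (G : SimpleGraph α) (H : SimpleGraph β) (a b : β) (z : α) (f : β → α)
    (hab : H.Adj a b) (hfa : f a = z) (hfb : f b = z)
    (hsurj : Function.Surjective f)
    (hinj : ∀ u v : β, u ≠ v → f u = f v → (u = a ∧ v = b) ∨ (u = b ∧ v = a))
    (hadj : ∀ x y : α,
      G.Adj x y ↔ x ≠ y ∧ ∃ u v : β, f u = x ∧ f v = y ∧ H.Adj u v) :
    (∃ φ : H.induce ({a}ᶜ : Set β) →g G, Function.Injective φ) ∧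
    entanglement (H.induce ({a}ᶜ : Set β)).Adj ≤ entanglement G.Adj ∧
    entanglement H.Adj - 1 ≤ entanglement G.Adj := by
  have hφ : Function.Injective fun v : ({a}ᶜ : Set β) => f v := fun u v huv => by
    by_contra hne
    rcases hinj u v (Subtype.coe_injective.ne hne) huv with ⟨h, -⟩ | ⟨-, h⟩
    · exact u.2 h
    · exact v.2 h
  have hhom : ∀ u v : ({a}ᶜ : Set β), (H.induce ({a}ᶜ : Set β)).Adj u v → G.Adj (f u) (f v) :=
    fun u v huv => (hadj _ _).2 ⟨fun h => huv.ne (hφ h), u, v, rfl, rfl, huv⟩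
  have hwin := (entCopsWin_entanglement G.Adj).of_injective_hom hφ hhom
  exact ⟨⟨⟨fun v => f v, fun {u v} => hhom u v⟩, hφ⟩, hwin.entanglement_le,
    Nat.sub_le_of_le_add hwin.succ_of_induce_compl_singleton.entanglement_le⟩
end
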